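/- For all partitions a, s in the k×l box and every integer r with 0 ≤ r ≤ k, the quantum Pieri numbers satisfy N(a, s, r) = N(â, c₁(ŝ), k − r), where â and ŝ are the Poincaré duals of a and s. (This identity is the combinatorial core of the paper's Theorem 1 that the bar involution respects the quantum product.) -/

import Mathlib

/-- `lam` (1-indexed; the relevant entries are `lam 1, …, lam l`) is a partition in the
`k × l` box, i.e. `k ≥ λ₁ ≥ λ₂ ≥ … ≥ λ_l ≥ 0`. -/
def IsBoxPartition (k l : ℕ) (lam : ℕ → ℤ) : Prop :=
  lam 1 ≤ (k : ℤ) ∧ (∀ i : ℕ, 1 ≤ i → i < l → lam (i + 1) ≤ lam i) ∧ 0 ≤ lam l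

/-- The Durfee number `d_λ`: the largest `i ∈ {1, …, l}` with `λ_i ≥ i`, and `0` if
no such `i` exists. -/
def durfee (l : ℕ) (lam : ℕ → ℤ) : ℕ :=
  (Finset.Icc 1 l).sup (fun i => if (i : ℤ) ≤ lam i then i else 0)

/-- The bar map `λ ↦ bar(λ)`:
`bar(λ)_i = d_λ + k − λ_{d_λ − i + 1}` for `1 ≤ i ≤ d_λ` and
`bar(λ)_i = d_λ − λ_{l − i + d_λ + 1}` for `d_λ < i ≤ l`. -/
def bar (k l : ℕ) (lam : ℕ → ℤ) : ℕ → ℤ := fun i =>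
  if i ≤ durfee l lam then
    (durfee l lam : ℤ) + (k : ℤ) - lam (durfee l lam - i + 1)
  else
    (durfee l lam : ℤ) - lam (l - i + durfee l lam + 1)

/-- The size `|λ| = λ₁ + ⋯ + λ_l` of a partition in the `k × l` box. -/
def boxSize (l : ℕ) (lam : ℕ → ℤ) : ℤ :=
  ∑ i ∈ Finset.Icc 1 l, lam i

/-- The Poincaré dual `κ̂` of a partition `κ` in the `k × l` box: `κ̂_i = k − κ_{l+1−i}`. -/
def dualP (k l : ℕ) (kap : ℕ → ℤ) : ℕ → ℤ := fun i =>
  (k : ℤ) - kap (l + 1 - i)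

/-- The cyclic shift `c₁` on partitions in the `k × l` box:
`c₁(κ) = (κ₁+1, …, κ_l+1)` if `κ₁ < k`, and `c₁(κ) = (κ₂, …, κ_l, 0)` if `κ₁ = k`. -/
def cyc (k l : ℕ) (kap : ℕ → ℤ) : ℕ → ℤ := fun i =>
  if kap 1 < (k : ℤ) then kap i + 1
  else if i = l then 0 else kap (i + 1)

open Classical in
/-- The quantum Pieri number `N(a, s, r) ∈ {0, 1}`, equal to `1` exactly in the two
cases (eq2) and (eq3) of the quantum Pieri formula, with the quantum parameter `q = 1`. -/
noncomputable def qPieri (k l : ℕ) (a s : ℕ → ℤ) (r : ℕ) : ℕ :=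
  if (boxSize l a + boxSize l s + (r : ℤ) = (k : ℤ) * l ∧
        (∀ i j : ℕ, 1 ≤ i → i ≤ l → 1 ≤ j → j ≤ l → i + j = l → (k : ℤ) ≤ a i + s j) ∧
        (∀ i j : ℕ, 1 ≤ i → i ≤ l → 1 ≤ j → j ≤ l → i + j = l + 1 → a i + s j ≤ (k : ℤ))) ∨
     (boxSize l a + boxSize l s + (r : ℤ) = (k : ℤ) * l + ((k : ℤ) + l) ∧
        (∀ i j : ℕ, 1 ≤ i → i ≤ l → 1 ≤ j → j ≤ l → i + j = l + 1 →
          (k : ℤ) + 1 ≤ a i + s j) ∧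
        (∀ i j : ℕ, 1 ≤ i → i ≤ l → 1 ≤ j → j ≤ l → i + j = l + 2 →
          a i + s j ≤ (k : ℤ) + 1))
  then 1 else 0

lemma boxSize_dualP (k l : ℕ) (f : ℕ → ℤ) :
    boxSize l (dualP k l f) = (k : ℤ) * l - boxSize l f := by
  have h : ∑ i ∈ Finset.Icc 1 l, f (l + 1 - i) = ∑ i ∈ Finset.Icc 1 l, f i := by
    apply Finset.sum_nbij' (fun i => l + 1 - i) (fun i => l + 1 - i)
    · intro i hi; simp only [Finset.mem_Icc] at *; omega
    · intro i hi; simp only [Finset.mem_Icc] at *; omega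
    · intro i hi; simp only [Finset.mem_Icc] at *; omega
    · intro i hi; simp only [Finset.mem_Icc] at *; omega
    · intro i hi; rfl
  simp only [boxSize, dualP, Finset.sum_sub_distrib, h, Finset.sum_const, Nat.card_Icc]
  simp [mul_comm]

lemma boxSize_cyc_lt (k l : ℕ) (f : ℕ → ℤ) (h : f 1 < k) :
    boxSize l (cyc k l f) = boxSize l f + l := by
  simp [boxSize, cyc, h, Finset.sum_add_distrib]

lemma boxSize_cyc_ge (k l : ℕ) (hl : 1 ≤ l) (f : ℕ → ℤ) (h : ¬ f 1 < k) :
    boxSize l (cyc k l f) = boxSize l f - f 1 := by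
  obtain ⟨m, rfl⟩ : ∃ m, l = m + 1 := ⟨l - 1, by omega⟩
  have e : ∀ g : ℕ → ℤ, boxSize (m + 1) g = ∑ i ∈ Finset.range (m + 1), g (i + 1) := by
    intro g
    unfold boxSize
    rw [Finset.range_eq_Ico, Finset.sum_Ico_add' g 0 (m + 1) 1]
    rfl
  rw [e, e, Finset.sum_range_succ, Finset.sum_range_succ']
  have : ∑ x ∈ Finset.range m, cyc k (m + 1) f (x + 1)
      = ∑ x ∈ Finset.range m, f (x + 1 + 1) := by
    apply Finset.sum_congr rfl
    intro x hx
    have := Finset.mem_range.1 hx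
    simp [cyc, h, this.ne]
  rw [this]
  simp [cyc, h]

/-- `N(a, s, r) = N(â, c₁(ŝ), k − r)` for all partitions `a, s` in the
`k × l` box and all `0 ≤ r ≤ k`. -/
theorem qPieri_dual (k l : ℕ) (hk : 1 ≤ k) (hl : 1 ≤ l)
    (a s : ℕ → ℤ) (ha : IsBoxPartition k l a) (hs : IsBoxPartition k l s)
    (r : ℕ) (hr : r ≤ k) :
    qPieri k l a s r = qPieri k l (dualP k l a) (cyc k l (dualP k l s)) (k - r) := by
  obtain ⟨ha1, -, hal⟩ := ha
  obtain ⟨-, -, hsl⟩ := hs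
  have hd1 : dualP k l s 1 = k - s l := by simp [dualP]
  unfold qPieri
  congr 1
  apply propext
  rw [boxSize_dualP]
  push_cast [hr]
  by_cases h : dualP k l s 1 < k
  · rw [boxSize_cyc_lt _ _ _ h, boxSize_dualP, or_comm]
    have hc : ∀ j, cyc k l (dualP k l s) j = k - s (l + 1 - j) + 1 := by
      intro j; simp only [cyc, h, if_true]; rfl
    simp only [hc]
    unfold dualP
    refine or_congr (and_congr ?_ (and_comm.trans (and_congr ?_ ?_)))
      (and_congr ?_ (and_comm.trans (and_congr ?_ ?_)))
    · constructor <;> intro H <;> linarith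
    · constructor
      · intro H i j h1 h2 h3 h4 h5
        have := H (l + 1 - i) (l + 1 - j) (by omega) (by omega) (by omega) (by omega) (by omega)
        linarith
      · intro H i j h1 h2 h3 h4 h5
        have := H (l + 1 - i) (l + 1 - j) (by omega) (by omega) (by omega) (by omega) (by omega)
        rw [show l + 1 - (l + 1 - i) = i by omega, show l + 1 - (l + 1 - j) = j by omega] at this
        linarith
    · constructor
      · intro H i j h1 h2 h3 h4 h5
        have := H (l + 1 - i) (l + 1 - j) (by omega) (by omega) (by omega) (by omega) (by omega)
        linarith
      · intro H i j h1 h2 h3 h4 h5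
        have := H (l + 1 - i) (l + 1 - j) (by omega) (by omega) (by omega) (by omega) (by omega)
        rw [show l + 1 - (l + 1 - i) = i by omega, show l + 1 - (l + 1 - j) = j by omega] at this
        linarith
    · constructor <;> intro H <;> linarith
    · constructor
      · intro H i j h1 h2 h3 h4 h5
        have := H (l + 1 - i) (l + 1 - j) (by omega) (by omega) (by omega) (by omega) (by omega)
        linarith
      · intro H i j h1 h2 h3 h4 h5
        have := H (l + 1 - i) (l + 1 - j) (by omega) (by omega) (by omega) (by omega) (by omega)
        rw [show l + 1 - (l + 1 - i) = i by omega, show l + 1 - (l + 1 - j) = j by omega] at this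
        linarith
    · constructor
      · intro H i j h1 h2 h3 h4 h5
        have := H (l + 1 - i) (l + 1 - j) (by omega) (by omega) (by omega) (by omega) (by omega)
        linarith
      · intro H i j h1 h2 h3 h4 h5
        have := H (l + 1 - i) (l + 1 - j) (by omega) (by omega) (by omega) (by omega) (by omega)
        rw [show l + 1 - (l + 1 - i) = i by omega, show l + 1 - (l + 1 - j) = j by omega] at this
        linarith
  · have hs0 : s l = 0 := by linarith
    rw [boxSize_cyc_ge _ _ hl _ h, boxSize_dualP, hd1, hs0]
    have hcl : cyc k l (dualP k l s) l = 0 := by simp [cyc, h]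
    have hc : ∀ j, j ≠ l → cyc k l (dualP k l s) j = k - s (l - j) := by
      intro j hj; simp [cyc, hj, dualP, hs0]
    have hda : ∀ i, dualP k l a i = k - a (l + 1 - i) := fun _ => rfl
    refine or_congr (and_congr ?_ (and_comm.trans (and_congr ?_ ?_))) (iff_of_false ?_ ?_)
    · constructor <;> intro H <;> linarith
    · constructor
      · intro H i j h1 h2 h3 h4 h5
        have := H (l + 1 - i) (l - j) (by omega) (by omega) (by omega) (by omega) (by omega)
        rw [hc j (by omega), hda]
        linarith
      · intro H i j h1 h2 h3 h4 h5
        by_cases hj : j = l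
        · obtain rfl : i = 1 := by omega
          rw [hj, hs0]; linarith
        have := H (l + 1 - i) (l - j) (by omega) (by omega) (by omega) (by omega) (by omega)
        rw [hc _ (by omega), hda, show l + 1 - (l + 1 - i) = i by omega,
          show l - (l - j) = j by omega] at this
        linarith
    · constructor
      · intro H i j h1 h2 h3 h4 h5
        by_cases hj : j = l
        · obtain rfl : i = 1 := by omega
          rw [hj, hcl, hda, Nat.add_sub_cancel]; linarith
        have := H (l + 1 - i) (l - j) (by omega) (by omega) (by omega) (by omega) (by omega)
        rw [hc j (by omega), hda]
        linarith
      · intro H i j h1 h2 h3 h4 h5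
        have := H (l + 1 - i) (l - j) (by omega) (by omega) (by omega) (by omega) (by omega)
        rw [hc _ (by omega), hda, show l + 1 - (l + 1 - i) = i by omega,
          show l - (l - j) = j by omega] at this
        linarith
    · rintro ⟨-, H, -⟩
      have := H 1 l le_rfl hl hl le_rfl (by omega)
      linarith
    · rintro ⟨-, H, -⟩
      have := H 1 l le_rfl hl hl le_rfl (by omega)
      rw [hcl, hda, Nat.add_sub_cancel] at this
      linarith
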